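/- arXiv:2009.03251 — 3 statements merged into one kernel-verified Lean document; each statement's English description precedes it below -/
import Mathlib

section
/- Let 0 < β ≤ 1/2 and ε > 0. Then there exists a constant C = C(β, ε) > 0 such that for all real numbers s, t with 0 < 2s ≤ t, one has Σ_{n₁, n₂ ∈ ℤ³} 1 / ( ⟨n₁⟩² ⟨n₂⟩² (1 + ‖n₀‖²)^{β} ⟨n₁ − n₂⟩^{2 − 2β + ε} ) ≤ C, where n₀ = (t n₁ + s n₂)/(t + s) ∈ ℝ³; in particular the bound is uniform over all such pairs (s, t). -/
noncomputable section

/-- Japanese bracket `⟨n⟩ = (1 + ‖n‖²)^{1/2}` of a lattice point `n ∈ ℤ³`. -/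
def jb (n : Fin 3 → ℤ) : ℝ :=
  Real.sqrt (1 + ∑ i, ((n i : ℝ)) ^ 2)

/-- The squared Japanese bracket `1 + ‖x‖²` of a point `x ∈ ℝ³`. -/
def bracketSq (x : Fin 3 → ℝ) : ℝ := 1 + ∑ i, x i ^ 2

lemma one_le_bracketSq (x : Fin 3 → ℝ) : 1 ≤ bracketSq x := by
  unfold bracketSq
  have : 0 ≤ ∑ i, x i ^ 2 := by positivity
  linarith

lemma bracketSq_pos (x : Fin 3 → ℝ) : 0 < bracketSq x :=
  one_pos.trans_le (one_le_bracketSq x)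

lemma jb_eq_sqrt_bracketSq (n : Fin 3 → ℤ) : jb n = √(bracketSq fun i => (n i : ℝ)) := rfl

lemma jb_sq (n : Fin 3 → ℤ) : jb n ^ 2 = bracketSq fun i => (n i : ℝ) := by
  rw [jb_eq_sqrt_bracketSq, Real.sq_sqrt (bracketSq_pos _).le]

lemma jb_rpow (n : Fin 3 → ℤ) (a : ℝ) :
    jb n ^ (2 * a) = (bracketSq fun i => (n i : ℝ)) ^ a := by
  rw [jb_eq_sqrt_bracketSq, Real.sqrt_eq_rpow, ← Real.rpow_mul (bracketSq_pos _).le]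
  congr 1
  ring

lemma one_le_jb (n : Fin 3 → ℤ) : 1 ≤ jb n := by
  rw [jb_eq_sqrt_bracketSq]
  exact Real.one_le_sqrt.2 (one_le_bracketSq _)

lemma summable_one_add_int_sq_rpow {a : ℝ} (ha : 1 / 2 < a) :
    Summable fun k : ℤ => (1 + (k : ℝ) ^ 2) ^ (-a) := by
  have hs : Summable fun k : ℤ => |(k : ℝ)| ^ (-(2 * a)) :=
    Real.summable_abs_int_rpow (by linarith)
  refine hs.of_norm_bounded_eventually ?_
  filter_upwards [(Set.finite_singleton (0 : ℤ)).compl_mem_cofinite] with k hk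
  have hk0 : (0 : ℝ) < |(k : ℝ)| := abs_pos.2 (by exact_mod_cast hk)
  rw [Real.norm_of_nonneg (by positivity), show -(2 * a) = (2 : ℝ) * -a by ring,
    Real.rpow_mul hk0.le, Real.rpow_two, sq_abs]
  exact Real.rpow_le_rpow_of_nonpos (by rw [← sq_abs]; positivity) (by linarith) (by linarith)

lemma summable_bracketSq_rpow {g : ℝ} (hg : 3 / 2 < g) :
    Summable fun n : Fin 3 → ℤ => (bracketSq fun i => (n i : ℝ)) ^ (-g) := by
  have h1 := summable_one_add_int_sq_rpow (a := g / 3) (by linarith)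
  have h2 := h1.mul_of_nonneg h1 (fun k => by positivity) (fun k => by positivity)
  have h3 := h1.mul_of_nonneg h2 (fun k => by positivity) (fun k => by positivity)
  have hinj : Function.Injective fun n : Fin 3 → ℤ => (n 0, n 1, n 2) := by
    intro m n h
    simp only [Prod.mk.injEq] at h
    ext i
    fin_cases i <;> simp [h]
  refine (h3.comp_injective hinj).of_nonneg_of_le
    (fun n => Real.rpow_nonneg (bracketSq_pos _).le _) fun n => ?_
  have key : ∀ i, (bracketSq fun i => (n i : ℝ)) ^ (-(g / 3)) ≤
      (1 + (n i : ℝ) ^ 2) ^ (-(g / 3)) := fun i =>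
    Real.rpow_le_rpow_of_nonpos (by positivity)
      (add_le_add_right (Finset.single_le_sum (f := fun i => (n i : ℝ) ^ 2)
        (fun j _ => sq_nonneg _) (Finset.mem_univ i)) 1) (by linarith)
  have h0 := Real.rpow_nonneg (bracketSq_pos fun i => (n i : ℝ)).le (-(g / 3))
  calc (bracketSq fun i => (n i : ℝ)) ^ (-g)
      = (bracketSq fun i => (n i : ℝ)) ^ (-(g / 3)) *
        ((bracketSq fun i => (n i : ℝ)) ^ (-(g / 3)) *
          (bracketSq fun i => (n i : ℝ)) ^ (-(g / 3))) := by
        rw [← Real.rpow_add (bracketSq_pos _), ← Real.rpow_add (bracketSq_pos _)]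
        congr 1
        ring
    _ ≤ _ := mul_le_mul (key 0) (mul_le_mul (key 1) (key 2) h0 (by positivity))
        (by positivity) (by positivity)

lemma bracketSq_add_round_le (n : Fin 3 → ℤ) (v : Fin 3 → ℝ) :
    (bracketSq fun i => ((n i + round (v i) : ℤ) : ℝ)) ≤
      5 / 2 * bracketSq fun i => (n i : ℝ) + v i := by
  have key : ∀ i, ((n i + round (v i) : ℤ) : ℝ) ^ 2 ≤ 2 * ((n i : ℝ) + v i) ^ 2 + 1 / 2 := by
    intro i
    have h := abs_le.1 (abs_sub_round (v i))
    push_cast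
    nlinarith [sq_nonneg ((n i : ℝ) + v i + (v i - round (v i)))]
  have h0 := key 0
  have h1 := key 1
  have h2 := key 2
  simp only [bracketSq, Fin.sum_univ_three]
  nlinarith [sq_nonneg ((n 0 : ℝ) + v 0), sq_nonneg ((n 1 : ℝ) + v 1),
    sq_nonneg ((n 2 : ℝ) + v 2)]

open scoped ENNReal in
/-- Sums of `⟨n + v⟩ ^ (-2 * g)` over `n ∈ ℤ³` are bounded uniformly in the shift `v ∈ ℝ³`. -/
lemma exists_tsum_shift_bracketSq_rpow_le {g : ℝ} (hg : 3 / 2 < g) :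
    ∃ K : ℝ≥0∞, K ≠ ∞ ∧ ∀ v : Fin 3 → ℝ,
      ∑' n : Fin 3 → ℤ, ENNReal.ofReal ((bracketSq fun i => (n i : ℝ) + v i) ^ (-g)) ≤ K := by
  refine ⟨ENNReal.ofReal ((5 / 2) ^ g) * ∑' n : Fin 3 → ℤ,
    ENNReal.ofReal ((bracketSq fun i => (n i : ℝ)) ^ (-g)),
    ENNReal.mul_ne_top ENNReal.ofReal_ne_top (summable_bracketSq_rpow hg).tsum_ofReal_ne_top,
    fun v => ?_⟩
  rw [← (Equiv.addRight fun i => round (v i)).tsum_eq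
    fun n : Fin 3 → ℤ => ENNReal.ofReal ((bracketSq fun i => (n i : ℝ)) ^ (-g)),
    ← ENNReal.tsum_mul_left]
  refine ENNReal.tsum_le_tsum fun n => ?_
  rw [← ENNReal.ofReal_mul (by positivity)]
  refine ENNReal.ofReal_le_ofReal ?_
  have h := Real.rpow_le_rpow_of_nonpos (z := -g) (bracketSq_pos _)
    (bracketSq_add_round_le n v) (by linarith)
  rw [Real.mul_rpow (by norm_num) (bracketSq_pos _).le, Real.rpow_neg (by norm_num)] at h
  have h5 : (0 : ℝ) < (5 / 2) ^ g := by positivity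
  rwa [inv_mul_le_iff₀ h5] at h

lemma bracketSq_le_of_sub_le {x y : Fin 3 → ℝ}
    (h : (bracketSq fun i => x i - y i) ≤ bracketSq x) : bracketSq y ≤ 4 * bracketSq x := by
  simp only [bracketSq, Fin.sum_univ_three] at *
  nlinarith [sq_nonneg (2 * x 0 - y 0), sq_nonneg (2 * x 1 - y 1), sq_nonneg (2 * x 2 - y 2)]

lemma bracketSq_le_of_le_sub {x y : Fin 3 → ℝ}
    (h : bracketSq x ≤ bracketSq fun i => x i - y i) :
    bracketSq y ≤ 4 * bracketSq fun i => x i - y i := by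
  simp only [bracketSq, Fin.sum_univ_three] at *
  nlinarith [sq_nonneg (2 * x 0 - y 0), sq_nonneg (2 * x 1 - y 1), sq_nonneg (2 * x 2 - y 2)]

lemma bracketSq_le_interpolate {x y : Fin 3 → ℝ} {θ : ℝ} (h0 : 0 ≤ θ) (h1 : θ ≤ 1 / 3)
    (h : (bracketSq fun i => x i - y i) ≤ bracketSq x) :
    bracketSq x ≤ 9 / 4 * bracketSq fun i => (1 - θ) * x i + θ * y i := by
  simp only [bracketSq, Fin.sum_univ_three] at *
  set X := x 0 ^ 2 + x 1 ^ 2 + x 2 ^ 2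
  set D := (x 0 - y 0) ^ 2 + (x 1 - y 1) ^ 2 + (x 2 - y 2) ^ 2
  have hX : 0 ≤ X := by positivity
  have e1 : ((1 - θ) * x 0 + θ * y 0) ^ 2 + ((1 - θ) * x 1 + θ * y 1) ^ 2 +
      ((1 - θ) * x 2 + θ * y 2) ^ 2 = (1 - θ) * X + θ * (y 0 ^ 2 + y 1 ^ 2 + y 2 ^ 2)
        - θ * (1 - θ) * D := by
    simp only [X, D]
    ring
  have e2 : 0 ≤ θ * (y 0 ^ 2 + y 1 ^ 2 + y 2 ^ 2) := by positivity
  have e3 : θ * (1 - θ) * D ≤ θ * (1 - θ) * X :=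
    mul_le_mul_of_nonneg_left (by linarith) (mul_nonneg h0 (by linarith))
  have e4 : 4 / 9 * X ≤ (1 - θ) ^ 2 * X := mul_le_mul_of_nonneg_right (by nlinarith) hX
  rw [e1]
  nlinarith

lemma bracketSq_add_smul_le {x y : Fin 3 → ℝ} {s t : ℝ} (hs : 0 < s) (hst : 2 * s ≤ t) :
    (bracketSq fun i => x i + s / t * y i) ≤
      9 / 4 * bracketSq fun i => (t * x i + s * y i) / (t + s) := by
  have ht : 0 < t := by linarith
  have key : ∀ i, (x i + s / t * y i) ^ 2 ≤ 9 / 4 * ((t * x i + s * y i) / (t + s)) ^ 2 := by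
    intro i
    have e : x i + s / t * y i = (t + s) / t * ((t * x i + s * y i) / (t + s)) := by
      field_simp
    have h0 : 0 ≤ (t + s) / t := by positivity
    have h1 : (t + s) / t ≤ 3 / 2 := by
      rw [div_le_iff₀ ht]
      linarith
    rw [e, mul_pow]
    exact mul_le_mul_of_nonneg_right (by nlinarith) (sq_nonneg _)
  have h0 := key 0
  have h1 := key 1
  have h2 := key 2
  simp only [bracketSq, Fin.sum_univ_three]
  linarith

lemma rpow_neg_le_of_le_mul {A B c p : ℝ} (hA : 0 < A) (hB : 0 < B) (hc : 0 < c)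
    (h : A ≤ c * B) (hp : 0 ≤ p) : B ^ (-p) ≤ c ^ p * A ^ (-p) := by
  have h := Real.rpow_le_rpow_of_nonpos (z := -p) hA h (by linarith)
  rwa [Real.mul_rpow hc.le hB.le, Real.rpow_neg hc.le, inv_mul_le_iff₀ (by positivity)] at h

lemma rpow_neg_add_le {A B D : ℝ} (hA : 0 < A) (hB : 0 < B) (hD : 0 < D) (hAB : A ≤ 4 * B)
    (hDB : D ≤ B) {p q : ℝ} (hp : 0 ≤ p) (hp1 : p ≤ 1) (hq : 0 ≤ q) :
    B ^ (-(p + q)) ≤ 4 * A ^ (-p) * D ^ (-q) := by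
  have h1 : B ^ (-p) ≤ 4 * A ^ (-p) :=
    (rpow_neg_le_of_le_mul hA hB (by norm_num) hAB hp).trans
      (mul_le_mul_of_nonneg_right
        (Real.rpow_le_self_of_one_le (by norm_num) hp1) (Real.rpow_nonneg hA.le _))
  have h2 : B ^ (-q) ≤ D ^ (-q) := Real.rpow_le_rpow_of_nonpos hD hDB (by linarith)
  rw [neg_add, Real.rpow_add hB]
  exact mul_le_mul h1 h2 (by positivity) (by positivity)

lemma rpow_neg_mul_rpow_neg_le_add {A B : ℝ} (hA : 0 < A) (hB : 0 < B) {p q : ℝ}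
    (hp : 0 ≤ p) (hq : 0 ≤ q) :
    A ^ (-p) * B ^ (-q) ≤ A ^ (-(p + q)) + B ^ (-(p + q)) := by
  rw [neg_add, Real.rpow_add hA, Real.rpow_add hB]
  rcases le_total A B with h | h
  · have := mul_le_mul_of_nonneg_left
      (Real.rpow_le_rpow_of_nonpos hA h (neg_nonpos.2 hq)) (Real.rpow_nonneg hA.le (-p))
    have : 0 ≤ B ^ (-p) * B ^ (-q) := by positivity
    linarith
  · have := mul_le_mul_of_nonneg_right
      (Real.rpow_le_rpow_of_nonpos hB h (neg_nonpos.2 hp)) (Real.rpow_nonneg hB.le (-q))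
    have : 0 ≤ A ^ (-p) * A ^ (-q) := by positivity
    linarith

/-- The summand is controlled by products that decouple once the second variable is fixed. -/
lemma summand_le {β η s t : ℝ} (hβ0 : 0 < β) (hβ : β ≤ 1 / 2) (hη : 0 < η) (hη1 : η ≤ 1 / 4)
    (hs : 0 < s) (hst : 2 * s ≤ t) (x y : Fin 3 → ℝ) :
    1 / (bracketSq x * bracketSq y *
        (bracketSq fun i => (t * x i + s * y i) / (t + s)) ^ β *
        (bracketSq fun i => x i - y i) ^ (1 - β + 2 * η)) ≤
      81 / 4 * (bracketSq y ^ (-(3 / 2 + η)) *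
        (bracketSq x ^ (-(3 / 2 + η)) + (bracketSq fun i => x i - y i) ^ (-(3 / 2 + η)) +
          (bracketSq fun i => x i + s / t * y i) ^ (-(3 / 2 + η)))) := by
  have ht : 0 < t := by linarith
  have hXZ : (bracketSq fun i => x i - y i) ≤ bracketSq x →
      bracketSq x ≤ 9 / 4 * bracketSq fun i => (t * x i + s * y i) / (t + s) := by
    intro h
    have hθ : s / (t + s) ≤ 1 / 3 := by
      rw [div_le_iff₀ (by positivity)]
      linarith
    have e : (fun i => (t * x i + s * y i) / (t + s)) =
        fun i => (1 - s / (t + s)) * x i + s / (t + s) * y i := by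
      ext i
      field_simp
      ring
    rw [e]
    exact bracketSq_le_interpolate (by positivity) hθ h
  have hWZ := bracketSq_add_smul_le (x := x) (y := y) hs hst
  have hYX := bracketSq_le_of_sub_le (x := x) (y := y)
  have hYD := bracketSq_le_of_le_sub (x := x) (y := y)
  have hX := bracketSq_pos x
  have hY := bracketSq_pos y
  have hZ := bracketSq_pos fun i => (t * x i + s * y i) / (t + s)
  have hD := bracketSq_pos fun i => x i - y i
  have hW := bracketSq_pos fun i => x i + s / t * y i
  generalize bracketSq x = X at *
  generalize bracketSq y = Y at *
  generalize (bracketSq fun i => (t * x i + s * y i) / (t + s)) = Z at *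
  generalize (bracketSq fun i => x i - y i) = D at *
  generalize (bracketSq fun i => x i + s / t * y i) = W at *
  have hXg : 0 ≤ Y ^ (-(3 / 2 + η)) * X ^ (-(3 / 2 + η)) := by positivity
  have hDg : 0 ≤ Y ^ (-(3 / 2 + η)) * D ^ (-(3 / 2 + η)) := by positivity
  have hWg : 0 ≤ Y ^ (-(3 / 2 + η)) * W ^ (-(3 / 2 + η)) := by positivity
  have hlhs : 1 / (X * Y * Z ^ β * D ^ (1 - β + 2 * η)) =
      X ^ (-1 : ℝ) * Y ^ (-1 : ℝ) * Z ^ (-β) * D ^ (-(1 - β + 2 * η)) := by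
    rw [Real.rpow_neg hZ.le, Real.rpow_neg hD.le, Real.rpow_neg_one, Real.rpow_neg_one,
      one_div, mul_inv, mul_inv, mul_inv]
  have hYexp : Y ^ (-(3 / 2 + η)) = Y ^ (-1 : ℝ) * Y ^ (-(1 / 2 + η)) := by
    rw [← Real.rpow_add hY]
    congr 1
    ring
  rw [hlhs]
  rcases le_total D X with h | h
  · have hZβ : Z ^ (-β) ≤ 9 / 4 * X ^ (-β) :=
      (rpow_neg_le_of_le_mul hX hZ (by norm_num) (hXZ h) hβ0.le).trans
        (mul_le_mul_of_nonneg_right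
          (Real.rpow_le_self_of_one_le (by norm_num) (by linarith)) (by positivity))
    have hex := rpow_neg_add_le hY hX hD (hYX h) h (p := 1 / 2 + η) (q := 1 / 2 + β - η)
      (by linarith) (by linarith) (by linarith)
    have hXexp : X ^ (-(1 / 2 + η + (1 / 2 + β - η))) = X ^ (-1 : ℝ) * X ^ (-β) := by
      rw [← Real.rpow_add hX]
      congr 1
      ring
    have hDexp : D ^ (-(3 / 2 + η)) = D ^ (-(1 / 2 + β - η)) * D ^ (-(1 - β + 2 * η)) := by
      rw [← Real.rpow_add hD]
      congr 1
      ring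
    calc X ^ (-1 : ℝ) * Y ^ (-1 : ℝ) * Z ^ (-β) * D ^ (-(1 - β + 2 * η))
        ≤ X ^ (-1 : ℝ) * Y ^ (-1 : ℝ) * (9 / 4 * X ^ (-β)) * D ^ (-(1 - β + 2 * η)) := by
          gcongr
      _ = 9 / 4 * X ^ (-(1 / 2 + η + (1 / 2 + β - η))) *
            (Y ^ (-1 : ℝ) * D ^ (-(1 - β + 2 * η))) := by
          rw [hXexp]
          ring
      _ ≤ 9 / 4 * (4 * Y ^ (-(1 / 2 + η)) * D ^ (-(1 / 2 + β - η))) *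
            (Y ^ (-1 : ℝ) * D ^ (-(1 - β + 2 * η))) := by
          gcongr
      _ = 9 * (Y ^ (-(3 / 2 + η)) * D ^ (-(3 / 2 + η))) := by
          rw [hYexp, hDexp]
          ring
      _ ≤ _ := by linarith
  · have hex := rpow_neg_add_le hY hD hX (hYD h) h (p := 1 / 2 + η) (q := 1 / 2 - β + η)
      (by linarith) (by linarith) (by linarith)
    rw [show 1 / 2 + η + (1 / 2 - β + η) = 1 - β + 2 * η by ring] at hex
    have hXexp : X ^ (-(3 / 2 - β + η)) = X ^ (-1 : ℝ) * X ^ (-(1 / 2 - β + η)) := by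
      rw [← Real.rpow_add hX]
      congr 1
      ring
    have hadd := rpow_neg_mul_rpow_neg_le_add hX hZ (p := 3 / 2 - β + η) (q := β)
      (by linarith) hβ0.le
    rw [show 3 / 2 - β + η + β = 3 / 2 + η by ring] at hadd
    have hZg : Z ^ (-(3 / 2 + η)) ≤ 81 / 16 * W ^ (-(3 / 2 + η)) := by
      refine (rpow_neg_le_of_le_mul hW hZ (by norm_num) hWZ (by linarith)).trans
        (mul_le_mul_of_nonneg_right ?_ (by positivity))
      calc (9 / 4 : ℝ) ^ (3 / 2 + η) ≤ (9 / 4 : ℝ) ^ (2 : ℝ) :=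
            Real.rpow_le_rpow_of_exponent_le (by norm_num) (by linarith)
        _ = 81 / 16 := by norm_num
    calc X ^ (-1 : ℝ) * Y ^ (-1 : ℝ) * Z ^ (-β) * D ^ (-(1 - β + 2 * η))
        ≤ X ^ (-1 : ℝ) * Y ^ (-1 : ℝ) * Z ^ (-β) *
            (4 * Y ^ (-(1 / 2 + η)) * X ^ (-(1 / 2 - β + η))) := by
          gcongr
      _ = 4 * Y ^ (-(3 / 2 + η)) * (X ^ (-(3 / 2 - β + η)) * Z ^ (-β)) := by
          rw [hYexp, hXexp]
          ring
      _ ≤ 4 * Y ^ (-(3 / 2 + η)) *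
            (X ^ (-(3 / 2 + η)) + 81 / 16 * W ^ (-(3 / 2 + η))) := by
          gcongr
          exact hadd.trans (by gcongr)
      _ ≤ _ := by linarith

open scoped ENNReal in
/-- The majorant of `summand_le` has a sum bounded uniformly in the parameter `r = s / t`. -/
lemma exists_tsum_majorant_le {g : ℝ} (hg : 3 / 2 < g) :
    ∃ B : ℝ≥0∞, B ≠ ∞ ∧ ∀ r : ℝ, ∑' p : (Fin 3 → ℤ) × (Fin 3 → ℤ),
      ENNReal.ofReal (81 / 4 * ((bracketSq fun i => (p.2 i : ℝ)) ^ (-g) *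
        ((bracketSq fun i => (p.1 i : ℝ)) ^ (-g) +
          (bracketSq fun i => (p.1 i : ℝ) - p.2 i) ^ (-g) +
          (bracketSq fun i => (p.1 i : ℝ) + r * p.2 i) ^ (-g)))) ≤ B := by
  obtain ⟨K, hK, hKle⟩ := exists_tsum_shift_bracketSq_rpow_le hg
  have hpos : ∀ x, 0 ≤ bracketSq x ^ (-g) := fun x => Real.rpow_nonneg (bracketSq_pos x).le _
  refine ⟨ENNReal.ofReal (81 / 4) * (K * (K + K + K)),
    by finiteness, fun r => ?_⟩
  have h0 := hKle fun _ => 0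
  simp only [add_zero] at h0
  rw [ENNReal.tsum_prod', ENNReal.tsum_comm]
  calc _ = ∑' y : Fin 3 → ℤ, ENNReal.ofReal (81 / 4) *
        (ENNReal.ofReal ((bracketSq fun i => (y i : ℝ)) ^ (-g)) *
        (∑' x : Fin 3 → ℤ, ENNReal.ofReal ((bracketSq fun i => (x i : ℝ)) ^ (-g)) +
          ∑' x : Fin 3 → ℤ, ENNReal.ofReal ((bracketSq fun i => (x i : ℝ) + -(y i)) ^ (-g)) +
          ∑' x : Fin 3 → ℤ,
            ENNReal.ofReal ((bracketSq fun i => (x i : ℝ) + r * y i) ^ (-g)))) := by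
        refine tsum_congr fun y => ?_
        rw [← ENNReal.tsum_add, ← ENNReal.tsum_add, ← ENNReal.tsum_mul_left,
          ← ENNReal.tsum_mul_left]
        refine tsum_congr fun x => ?_
        rw [ENNReal.ofReal_mul (by norm_num), ENNReal.ofReal_mul (hpos _),
          ENNReal.ofReal_add (add_nonneg (hpos _) (hpos _)) (hpos _),
          ENNReal.ofReal_add (hpos _) (hpos _)]
        simp only [sub_eq_add_neg]
    _ ≤ ∑' y : Fin 3 → ℤ, ENNReal.ofReal (81 / 4) *
        (ENNReal.ofReal ((bracketSq fun i => (y i : ℝ)) ^ (-g)) * (K + K + K)) := by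
        gcongr with y
        · exact hKle fun i => -(y i : ℝ)
        · exact hKle fun i => r * y i
    _ ≤ _ := by
        rw [ENNReal.tsum_mul_left, ENNReal.tsum_mul_right]
        gcongr

theorem uniform_weighted_lattice_sum
    (β ε : ℝ) (hβ0 : 0 < β) (hβ : β ≤ 1 / 2) (hε : 0 < ε) :
    ∃ C : ℝ, 0 < C ∧ ∀ s t : ℝ, 0 < s → 2 * s ≤ t → ∃ L : ℝ,
      HasSum (fun p : (Fin 3 → ℤ) × (Fin 3 → ℤ) =>
        1 / (jb p.1 ^ 2 * jb p.2 ^ 2 *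
          (1 + ∑ i, ((t * (p.1 i : ℝ) + s * (p.2 i : ℝ)) / (t + s)) ^ 2) ^ β *
          jb (p.1 - p.2) ^ (2 - 2 * β + ε))) L ∧
      L ≤ C := by
  set η := min ε 1 / 4 with hηdef
  have hη : 0 < η := by positivity
  have hη1 : η ≤ 1 / 4 := by linarith [min_le_right ε 1]
  have hηε : 4 * η ≤ ε := by linarith [min_le_left ε 1]
  obtain ⟨B, hB, hBle⟩ := exists_tsum_majorant_le (g := 3 / 2 + η) (by linarith)
  refine ⟨B.toReal + 1, by positivity, fun s t hs hst => ?_⟩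
  set F := fun p : (Fin 3 → ℤ) × (Fin 3 → ℤ) =>
    1 / (jb p.1 ^ 2 * jb p.2 ^ 2 *
      (1 + ∑ i, ((t * (p.1 i : ℝ) + s * (p.2 i : ℝ)) / (t + s)) ^ 2) ^ β *
      jb (p.1 - p.2) ^ (2 - 2 * β + ε)) with hF
  have hjb : ∀ n, 0 < jb n := fun n => one_pos.trans_le (one_le_jb n)
  have hF0 : ∀ p, 0 ≤ F p := fun p => by
    have := hjb (p.1 - p.2)
    positivity
  have hFle : ∑' p, ENNReal.ofReal (F p) ≤ B := by
    refine (ENNReal.tsum_le_tsum fun p => ENNReal.ofReal_le_ofReal ?_).trans (hBle (s / t))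
    refine le_trans ?_ (summand_le hβ0 hβ hη hη1 hs hst (fun i => (p.1 i : ℝ))
      fun i => (p.2 i : ℝ))
    have hd : (bracketSq fun i => (p.1 i : ℝ) - p.2 i) ^ (1 - β + 2 * η) ≤
        jb (p.1 - p.2) ^ (2 - 2 * β + ε) := by
      have e := jb_rpow (p.1 - p.2) (1 - β + 2 * η)
      simp only [Pi.sub_apply, Int.cast_sub] at e
      rw [← e]
      exact Real.rpow_le_rpow_of_exponent_le (one_le_jb _) (by linarith)
    have hX := bracketSq_pos fun i => (p.1 i : ℝ)
    have hY := bracketSq_pos fun i => (p.2 i : ℝ)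
    have hZ := bracketSq_pos fun i => (t * (p.1 i : ℝ) + s * p.2 i) / (t + s)
    have hD := bracketSq_pos fun i => (p.1 i : ℝ) - p.2 i
    simp only [hF, jb_sq]
    exact one_div_le_one_div_of_le (by positivity)
      (mul_le_mul_of_nonneg_left hd (mul_nonneg (by positivity) (Real.rpow_nonneg hZ.le _)))
  have hsum : Summable F := by
    have h := ENNReal.summable_toReal (ne_top_of_le_ne_top hB hFle)
    simpa only [ENNReal.toReal_ofReal (hF0 _)] using h
  refine ⟨∑' p, F p, hsum.hasSum, ?_⟩
  rw [← ENNReal.ofReal_tsum_of_nonneg hF0 hsum] at hFle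
  linarith [(ENNReal.ofReal_le_iff_le_toReal hB).1 hFle]

end
end

section
/- Let β > 1/2. Then the triple series Σ_{n₁, n₂, n₃ ∈ ℤ³} ⟨n₁ + n₂⟩^{−2β} ⟨n₁⟩^{−2} ⟨n₂⟩^{−2} ⟨n₃⟩^{−2} ⟨n₁ + n₂ + n₃⟩^{−2} converges. -/
noncomputable section

lemma jb_pos (n : Fin 3 → ℤ) : 0 < jb n :=
  one_pos.trans_le (one_le_jb n)

lemma jb_neg (n : Fin 3 → ℤ) : jb (-n) = jb n := by
  simp [jb]

lemma jb_add_le (m n : Fin 3 → ℤ) : jb (m + n) ≤ jb m + jb n := by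
  have hm : jb m ^ 2 = 1 + ∑ i, ((m i : ℝ)) ^ 2 := Real.sq_sqrt (by positivity)
  have hn : jb n ^ 2 = 1 + ∑ i, ((n i : ℝ)) ^ 2 := Real.sq_sqrt (by positivity)
  have hcs := Finset.sum_mul_sq_le_sq_mul_sq Finset.univ
    (fun i => (m i : ℝ)) (fun i => (n i : ℝ))
  have hinner : ∑ i, (m i : ℝ) * n i ≤ jb m * jb n := by
    refine abs_le_of_sq_le_sq' ?_ (mul_nonneg (jb_pos m).le (jb_pos n).le) |>.2
    rw [mul_pow, hm, hn]
    refine hcs.trans (mul_le_mul ?_ ?_ ?_ ?_) <;> first | linarith | positivity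
  have hpos := add_pos (jb_pos m) (jb_pos n)
  rw [jb, Real.sqrt_le_left hpos.le, add_sq, hm, hn]
  have hexp : ∑ i, (((m + n) i : ℤ) : ℝ) ^ 2 =
      ∑ i, (m i : ℝ) ^ 2 + 2 * ∑ i, (m i : ℝ) * n i + ∑ i, (n i : ℝ) ^ 2 := by
    rw [Finset.mul_sum, ← Finset.sum_add_distrib, ← Finset.sum_add_distrib]
    refine Finset.sum_congr rfl fun i _ => ?_
    push_cast [Pi.add_apply]
    ring
  rw [hexp]
  linarith

lemma summable_one_add_sq_rpow {r : ℝ} (hr : 1 / 2 < r) :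
    Summable fun k : ℤ => (1 + (k : ℝ) ^ 2) ^ (-r) := by
  refine Summable.of_norm_bounded_eventually
    (Real.summable_abs_int_rpow (b := 2 * r) (by linarith)) ?_
  refine (Set.finite_singleton (0 : ℤ)).subset fun k hk => ?_
  by_contra hk0
  refine hk ?_
  have hpos : 0 < |(k : ℝ)| := abs_pos.2 (Int.cast_ne_zero.2 hk0)
  rw [Set.mem_ofPred_eq, Real.norm_of_nonneg (by positivity), neg_mul_eq_mul_neg, Real.rpow_mul hpos.le,
    Real.rpow_two]
  exact Real.rpow_le_rpow_of_nonpos (by positivity) (by linarith [sq_abs (k : ℝ)])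
    (by linarith)

lemma summable_jb_rpow {s : ℝ} (hs : 3 < s) :
    Summable fun n : Fin 3 → ℤ => jb n ^ (-s) := by
  have h := summable_one_add_sq_rpow (r := s / 6) (by linarith)
  have hnn : 0 ≤ fun k : ℤ => (1 + (k : ℝ) ^ 2) ^ (-(s / 6)) := fun k => by positivity
  have h3 := h.mul_of_nonneg (h.mul_of_nonneg h hnn hnn) hnn
    fun p => mul_nonneg (hnn p.1) (hnn p.2)
  have hinj : Function.Injective fun n : Fin 3 → ℤ => (n 0, n 1, n 2) := by
    intro m n hmn
    simp only [Prod.mk.injEq] at hmn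
    ext i
    fin_cases i
    exacts [hmn.1, hmn.2.1, hmn.2.2]
  refine Summable.of_nonneg_of_le (fun n => Real.rpow_nonneg (jb_pos n).le _) (fun n => ?_)
    (h3.comp_injective hinj)
  have hle (i : Fin 3) : (jb n ^ 2) ^ (-(s / 6)) ≤ (1 + (n i : ℝ) ^ 2) ^ (-(s / 6)) := by
    refine Real.rpow_le_rpow_of_nonpos (by positivity) ?_ (by linarith)
    rw [jb, Real.sq_sqrt (by positivity)]
    gcongr
    exact Finset.single_le_sum (f := fun j => (n j : ℝ) ^ 2) (fun j _ => sq_nonneg _)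
      (Finset.mem_univ i)
  have hsplit : jb n ^ (-s) =
      (jb n ^ 2) ^ (-(s / 6)) * ((jb n ^ 2) ^ (-(s / 6)) * (jb n ^ 2) ^ (-(s / 6))) := by
    rw [← Real.rpow_two, ← Real.rpow_mul (jb_pos n).le, ← Real.rpow_add (jb_pos n),
      ← Real.rpow_add (jb_pos n)]
    ring_nf
  rw [hsplit]
  have hnn' : 0 ≤ (jb n ^ 2) ^ (-(s / 6)) := by positivity
  exact mul_le_mul (hle 0) (mul_le_mul (hle 1) (hle 2) hnn' (by positivity))
    (by positivity) (by positivity)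

lemma rpow_neg_two_mul_le_of_le {x y z ε : ℝ} (hx : 1 ≤ x) (hz : 1 ≤ z) (hxy : x ≤ y)
    (hzxy : z ≤ x + y) (hε : 0 < ε) (hε1 : ε ≤ 1) :
    x ^ (-2 : ℝ) * y ^ (-2 : ℝ) ≤ 2 * z ^ (-(1 - ε)) * x ^ (-(3 + ε)) := by
  have hx0 : 0 < x := by linarith
  have hy0 : 0 < y := by linarith
  have hz0 : 0 < z := by linarith
  have h1 : y ^ (-(1 - ε)) ≤ 2 * z ^ (-(1 - ε)) :=
    calc y ^ (-(1 - ε)) ≤ (z / 2) ^ (-(1 - ε)) :=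
          Real.rpow_le_rpow_of_nonpos (by positivity) (by linarith) (by linarith)
      _ = 2 ^ (1 - ε) * z ^ (-(1 - ε)) := by
          rw [Real.div_rpow hz0.le zero_le_two, Real.rpow_neg zero_le_two, div_inv_eq_mul,
            mul_comm]
      _ ≤ 2 * z ^ (-(1 - ε)) := by
          gcongr
          exact Real.rpow_le_self_of_one_le one_le_two (by linarith)
  have h2 : y ^ (-(1 + ε)) ≤ x ^ (-(1 + ε)) :=
    Real.rpow_le_rpow_of_nonpos hx0 hxy (by linarith)
  calc x ^ (-2 : ℝ) * y ^ (-2 : ℝ) = x ^ (-2 : ℝ) * (y ^ (-(1 - ε)) * y ^ (-(1 + ε))) := by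
        rw [← Real.rpow_add hy0]
        ring_nf
    _ ≤ x ^ (-2 : ℝ) * (2 * z ^ (-(1 - ε)) * x ^ (-(1 + ε))) := by gcongr
    _ = 2 * z ^ (-(1 - ε)) * (x ^ (-2 : ℝ) * x ^ (-(1 + ε))) := by ring
    _ = 2 * z ^ (-(1 - ε)) * x ^ (-(3 + ε)) := by
        rw [← Real.rpow_add hx0]
        ring_nf

lemma rpow_neg_two_mul_le {x y z ε : ℝ} (hx : 1 ≤ x) (hy : 1 ≤ y) (hz : 1 ≤ z)
    (hzxy : z ≤ x + y) (hε : 0 < ε) (hε1 : ε ≤ 1) :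
    x ^ (-2 : ℝ) * y ^ (-2 : ℝ) ≤
      2 * z ^ (-(1 - ε)) * (x ^ (-(3 + ε)) + y ^ (-(3 + ε))) := by
  rcases le_total x y with h | h
  · refine (rpow_neg_two_mul_le_of_le hx hz h hzxy hε hε1).trans ?_
    gcongr
    exact le_add_of_nonneg_right (by positivity)
  · rw [mul_comm]
    refine (rpow_neg_two_mul_le_of_le hy hz h (by linarith) hε hε1).trans ?_
    gcongr
    exact le_add_of_nonneg_left (by positivity)

lemma summable_jb_rpow_mul_mul {ι : Type*} {s : ℝ} (hs : 3 < s)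
    (f g h : ι → Fin 3 → ℤ) (hinj : Function.Injective fun p => (f p, g p, h p)) :
    Summable fun p => jb (f p) ^ (-s) * (jb (g p) ^ (-s) * jb (h p) ^ (-s)) := by
  have hS := summable_jb_rpow hs
  have hnn : 0 ≤ fun n : Fin 3 → ℤ => jb n ^ (-s) := fun n => Real.rpow_nonneg (jb_pos n).le _
  have hprod := hS.mul_of_nonneg (hS.mul_of_nonneg hS hnn hnn) hnn
    fun p => mul_nonneg (hnn p.1) (hnn p.2)
  simpa only [Function.comp_def] using hprod.comp_injective hinj

theorem quartic_chaos_triple_sum_summable (β : ℝ) (hβ : 1 / 2 < β) :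
    Summable (fun p : (Fin 3 → ℤ) × (Fin 3 → ℤ) × (Fin 3 → ℤ) =>
      jb (p.1 + p.2.1) ^ (-(2 * β)) * jb p.1 ^ (-(2 : ℝ)) * jb p.2.1 ^ (-(2 : ℝ)) *
        jb p.2.2 ^ (-(2 : ℝ)) * jb (p.1 + p.2.1 + p.2.2) ^ (-(2 : ℝ))) := by
  obtain ⟨ε, hε, hε1, hεβ⟩ : ∃ ε : ℝ, 0 < ε ∧ ε ≤ 1 ∧ 3 * ε ≤ 2 * β - 1 :=
    ⟨min 1 ((2 * β - 1) / 3), lt_min one_pos (by linarith), min_le_left _ _, by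
      linarith [min_le_right 1 ((2 * β - 1) / 3)]⟩
  have hs : 3 < 3 + ε := by linarith
  have key := (((summable_jb_rpow_mul_mul
      (ι := (Fin 3 → ℤ) × (Fin 3 → ℤ) × (Fin 3 → ℤ)) hs
      (fun p => p.1 + p.2.1) (fun p => p.1) (fun p => p.2.2) ?_).add
    (summable_jb_rpow_mul_mul hs
      (fun p => p.1 + p.2.1) (fun p => p.1) (fun p => p.1 + p.2.1 + p.2.2) ?_)).add
    ((summable_jb_rpow_mul_mul hs
      (fun p => p.1 + p.2.1) (fun p => p.2.1) (fun p => p.2.2) ?_).add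
    (summable_jb_rpow_mul_mul hs
      (fun p => p.1 + p.2.1) (fun p => p.2.1) (fun p => p.1 + p.2.1 + p.2.2) ?_))).mul_left 4
  · refine Summable.of_nonneg_of_le (fun p => ?_) (fun p => ?_) key
    · have h (n : Fin 3 → ℤ) (r : ℝ) : 0 ≤ jb n ^ r := Real.rpow_nonneg (jb_pos n).le r
      exact mul_nonneg (mul_nonneg (mul_nonneg (mul_nonneg (h _ _) (h _ _)) (h _ _)) (h _ _))
        (h _ _)
    · obtain ⟨a, b, c⟩ := p
      have hab := rpow_neg_two_mul_le (one_le_jb a) (one_le_jb b) (one_le_jb (a + b))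
        (jb_add_le a b) hε hε1
      have hcd := rpow_neg_two_mul_le (one_le_jb c) (one_le_jb (a + b + c)) (one_le_jb (a + b))
        (by simpa [jb_neg, add_comm] using jb_add_le (a + b + c) (-c)) hε hε1
      have hm : jb (a + b) ^ (-(2 * β)) * (jb (a + b) ^ (-(1 - ε)) * jb (a + b) ^ (-(1 - ε))) ≤
          jb (a + b) ^ (-(3 + ε)) := by
        rw [← Real.rpow_add (jb_pos _), ← Real.rpow_add (jb_pos _)]
        exact Real.rpow_le_rpow_of_exponent_le (one_le_jb _) (by linarith)
      dsimp only
      have := jb_pos a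
      have := jb_pos b
      have := jb_pos c
      have := jb_pos (a + b)
      have := jb_pos (a + b + c)
      generalize jb (a + b + c) = d at *
      generalize jb (a + b) = m at *
      generalize jb a = x at *
      generalize jb b = y at *
      generalize jb c = z at *
      calc _ = m ^ (-(2 * β)) *
            ((x ^ (-2 : ℝ) * y ^ (-2 : ℝ)) * (z ^ (-2 : ℝ) * d ^ (-2 : ℝ))) := by ring
        _ ≤ m ^ (-(2 * β)) *
            ((2 * m ^ (-(1 - ε)) * (x ^ (-(3 + ε)) + y ^ (-(3 + ε)))) *
              (2 * m ^ (-(1 - ε)) * (z ^ (-(3 + ε)) + d ^ (-(3 + ε))))) := by gcongr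
        _ = (m ^ (-(2 * β)) * (m ^ (-(1 - ε)) * m ^ (-(1 - ε)))) *
            (4 * ((x ^ (-(3 + ε)) + y ^ (-(3 + ε))) * (z ^ (-(3 + ε)) + d ^ (-(3 + ε))))) := by
          ring
        _ ≤ m ^ (-(3 + ε)) *
            (4 * ((x ^ (-(3 + ε)) + y ^ (-(3 + ε))) * (z ^ (-(3 + ε)) + d ^ (-(3 + ε))))) := by
          gcongr
        _ = _ := by ring
  all_goals
    rintro ⟨a, b, c⟩ ⟨a', b', c'⟩ h
    simp only [Prod.mk.injEq] at h ⊢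
    obtain ⟨h1, h2, h3⟩ := h
    subst h2
    simp_all

end
end

section
/- There exists a constant C > 0 such that for all n, n₂ ∈ ℤ³ with ‖n‖ ≤ ‖n₂‖, one has | (3/4 + ‖n + n₂‖²)^{1/2} − (3/4 + ‖n₂‖²)^{1/2} − (n · n₂) / (3/4 + ‖n₂‖²)^{1/2} | ≤ C (1 + ‖n‖²) / (3/4 + ‖n₂‖²)^{1/2}. -/
noncomputable section

/-- Euclidean norm `‖n‖` of a lattice point `n ∈ ℤ³`. -/
def latNorm (n : Fin 3 → ℤ) : ℝ :=
  Real.sqrt (∑ i, ((n i : ℝ)) ^ 2)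

/-- The first-order expansion of `√(c + ‖x + y‖²)` around `y` has error at most
`‖x‖² / (2 √(c + ‖y‖²))`. -/
theorem abs_sqrt_add_sum_sq_expansion_le {ι : Type*} [Fintype ι] {c : ℝ} (hc : 0 < c)
    (x y : ι → ℝ) :
    |√(c + ∑ i, (x i + y i) ^ 2) - √(c + ∑ i, y i ^ 2)
        - (∑ i, x i * y i) / √(c + ∑ i, y i ^ 2)|
      ≤ (∑ i, x i ^ 2) / 2 / √(c + ∑ i, y i ^ 2) := by
  have hcs : (∑ i, x i * y i) ^ 2 ≤ (∑ i, x i ^ 2) * ∑ i, y i ^ 2 :=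
    Finset.sum_mul_sq_le_sq_mul_sq _ x y
  have hsum : ∑ i, (x i + y i) ^ 2 = ∑ i, x i ^ 2 + 2 * ∑ i, x i * y i + ∑ i, y i ^ 2 := by
    rw [Finset.mul_sum, ← Finset.sum_add_distrib, ← Finset.sum_add_distrib]
    exact Finset.sum_congr rfl fun i _ => by ring
  have hx : 0 ≤ ∑ i, x i ^ 2 := Finset.sum_nonneg fun i _ => sq_nonneg _
  have hy : 0 ≤ ∑ i, y i ^ 2 := Finset.sum_nonneg fun i _ => sq_nonneg _
  have hxy : 0 ≤ ∑ i, (x i + y i) ^ 2 := Finset.sum_nonneg fun i _ => sq_nonneg _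
  have hA := Real.sq_sqrt (show 0 ≤ c + ∑ i, (x i + y i) ^ 2 by positivity)
  have hB := Real.sq_sqrt (show 0 ≤ c + ∑ i, y i ^ 2 by positivity)
  have hA0 := Real.sqrt_nonneg (c + ∑ i, (x i + y i) ^ 2)
  have hB0 : 0 < √(c + ∑ i, y i ^ 2) := Real.sqrt_pos.2 (by positivity)
  generalize √(c + ∑ i, (x i + y i) ^ 2) = A at *
  generalize √(c + ∑ i, y i ^ 2) = B at *
  rw [hsum] at hA
  generalize ∑ i, x i ^ 2 = S at *
  generalize ∑ i, x i * y i = d at *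
  generalize ∑ i, y i ^ 2 = T at *
  have hlow : B ^ 2 + d ≤ A * B := by
    refine le_of_abs_le (abs_le_of_sq_le_sq ?_ (by positivity))
    rw [mul_pow, hA, hB]
    nlinarith [mul_nonneg hc.le hx]
  have hrw : A - B - d / B = (A * B - B ^ 2 - d) / B := by
    field_simp
  rw [hrw, abs_div, abs_of_pos hB0]
  gcongr
  rw [abs_of_nonneg (by linarith)]
  nlinarith [sq_nonneg (A - B)]

theorem phase_function_expansion :
    ∃ C : ℝ, 0 < C ∧ ∀ n n₂ : Fin 3 → ℤ, latNorm n ≤ latNorm n₂ →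
      |Real.sqrt (3 / 4 + ∑ i, ((n i : ℝ) + (n₂ i : ℝ)) ^ 2)
          - Real.sqrt (3 / 4 + ∑ i, ((n₂ i : ℝ)) ^ 2)
          - (∑ i, (n i : ℝ) * (n₂ i : ℝ)) / Real.sqrt (3 / 4 + ∑ i, ((n₂ i : ℝ)) ^ 2)|
        ≤ C * (1 + ∑ i, ((n i : ℝ)) ^ 2) / Real.sqrt (3 / 4 + ∑ i, ((n₂ i : ℝ)) ^ 2) := by
  refine ⟨1, one_pos, fun n n₂ _ => ?_⟩
  refine (abs_sqrt_add_sum_sq_expansion_le (by norm_num) _ _).trans ?_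
  have hn : 0 ≤ ∑ i, (n i : ℝ) ^ 2 := Finset.sum_nonneg fun i _ => sq_nonneg _
  gcongr
  linarith

end
end
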